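/- Let ξ be a cost-sharing scheme satisfying Fence Monotonicity, let S ⊆ A, and let i,j ∈ S be two distinct players with ξ(j,S∖{i}) < ξ(j,S). Then: (a) ξ(k,S∖{i}) ≤ ξ(k,S) for every k ∈ S∖{i,j}; (b) ξ(i,S∖{j}) ≤ ξ(i,S); and (c) ξ(i,S∖{j}) ≥ ξ(i,S). -/

import Mathlib

open Finset

variable {n : ℕ}

/-- A cost-sharing scheme: nonnegative payments, and zero payment for non-serviced players. -/
def IsCostSharingScheme (ξ : Fin n → Finset (Fin n) → ℝ) : Prop :=
  (∀ i S, 0 ≤ ξ i S) ∧ (∀ i S, i ∉ S → ξ i S = 0)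

/-- The minimum payment ξ*(i,L,U) = min{ ξ(i,S) : L ⊆ S ⊆ U, i ∈ S }. -/
noncomputable def xiStar (ξ : Fin n → Finset (Fin n) → ℝ) (L U : Finset (Fin n)) (i : Fin n) : ℝ :=
  sInf {x : ℝ | ∃ S : Finset (Fin n), L ⊆ S ∧ S ⊆ U ∧ i ∈ S ∧ ξ i S = x}

/-- Fence Monotonicity at a pair L ⊆ U. -/
def FenceMonoAt (ξ : Fin n → Finset (Fin n) → ℝ) (L U : Finset (Fin n)) : Prop :=
  (∃ S : Finset (Fin n), L ⊆ S ∧ S ⊆ U ∧ ∀ i ∈ S, ξ i S = xiStar ξ L U i) ∧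
  (∀ i ∈ U \ L, ∃ S : Finset (Fin n), L ⊆ S ∧ S ⊆ U ∧ i ∈ S ∧
    ∀ j ∈ S \ L, ξ j S = xiStar ξ L U j) ∧
  (∀ C : Finset (Fin n), C ⊂ U → (∃ i ∈ C, ξ i C < xiStar ξ L U i) →
    ∃ T : Finset (Fin n), T.Nonempty ∧ T ⊆ L \ C ∧ ∀ j ∈ T, ξ j (C ∪ T) = xiStar ξ L U j)

/-- Fence Monotonicity: the three conditions hold at every pair L ⊆ U. -/
def FenceMonotone (ξ : Fin n → Finset (Fin n) → ℝ) : Prop :=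
  ∀ L U : Finset (Fin n), L ⊆ U → FenceMonoAt ξ L U

/-- Voluntary participation: a serviced player is never charged more than her bid. -/
def VP (ξ : Fin n → Finset (Fin n) → ℝ) (O : (Fin n → ℝ) → Finset (Fin n)) : Prop :=
  ∀ b : Fin n → ℝ, ∀ i ∈ O b, ξ i (O b) ≤ b i

/-- Consumer sovereignty: each player has a bid that guarantees service. -/
def CS (O : (Fin n → ℝ) → Finset (Fin n)) : Prop :=
  ∀ i : Fin n, ∃ bstar : ℝ, ∀ b : Fin n → ℝ, b i = bstar → i ∈ O b

/-- Utility of player `i` with true value `v i` at bid vector `b`. -/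
noncomputable def utility (ξ : Fin n → Finset (Fin n) → ℝ) (O : (Fin n → ℝ) → Finset (Fin n))
    (v b : Fin n → ℝ) (i : Fin n) : ℝ :=
  if i ∈ O b then v i - ξ i (O b) else 0

/-- Group-strategyproofness. -/
def GSP (ξ : Fin n → Finset (Fin n) → ℝ) (O : (Fin n → ℝ) → Finset (Fin n)) : Prop :=
  ∀ v v' : Fin n → ℝ,
    (∃ i : Fin n, v i ≠ v' i ∧ utility ξ O v v' i < utility ξ O v v i) ∨
    (∀ i : Fin n, utility ξ O v v' i = utility ξ O v v i)

/-- The pair (L,U) is stable at the bid vector b. -/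
def StablePair (ξ : Fin n → Finset (Fin n) → ℝ) (b : Fin n → ℝ) (L U : Finset (Fin n)) : Prop :=
  L ⊆ U ∧
  (∀ i ∈ L, xiStar ξ L U i < b i) ∧
  (∀ i ∈ U \ L, b i = xiStar ξ L U i) ∧
  (∀ R : Finset (Fin n), R ⊆ Uᶜ → R.Nonempty → ∃ i ∈ R, b i < xiStar ξ L (U ∪ R) i)

/-- Player i harms player j (at the pair L ⊆ U). -/
def Harms (ξ : Fin n → Finset (Fin n) → ℝ) (L U : Finset (Fin n)) (i j : Fin n) : Prop :=
  j ≠ i ∧ xiStar ξ L U j < xiStar ξ (insert i L) U j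

theorem xiStar_le {ξ : Fin n → Finset (Fin n) → ℝ} (hξ : IsCostSharingScheme ξ)
    {L S U : Finset (Fin n)} {i : Fin n} (hLS : L ⊆ S) (hSU : S ⊆ U) (hi : i ∈ S) :
    xiStar ξ L U i ≤ ξ i S := by
  refine csInf_le ⟨0, ?_⟩ ⟨S, hLS, hSU, hi, rfl⟩
  rintro _ ⟨R, -, -, -, rfl⟩
  exact hξ.1 i R

theorem eq_or_eq_erase_of_erase_subset {S T : Finset (Fin n)} {i : Fin n}
    (h : S.erase i ⊆ T) (hT : T ⊆ S) : T = S ∨ T = S.erase i := by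
  by_cases hi : i ∈ T
  · exact .inl (hT.antisymm fun x hx => if hxi : x = i then hxi ▸ hi else
      h (mem_erase.2 ⟨hxi, hx⟩))
  · exact .inr ((subset_erase.2 ⟨hT, hi⟩).antisymm h)

theorem xiStar_erase_self {ξ : Fin n → Finset (Fin n) → ℝ} {S : Finset (Fin n)} {i : Fin n}
    (hi : i ∈ S) : xiStar ξ (S.erase i) S i = ξ i S := by
  have hset : {x : ℝ | ∃ T : Finset (Fin n), S.erase i ⊆ T ∧ T ⊆ S ∧ i ∈ T ∧ ξ i T = x} =
      {ξ i S} := by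
    ext x
    constructor
    · rintro ⟨T, hLT, hTS, hiT, rfl⟩
      rcases eq_or_eq_erase_of_erase_subset hLT hTS with rfl | rfl
      · rfl
      · simp at hiT
    · rintro rfl
      exact ⟨S, erase_subset i S, Subset.rfl, hi, rfl⟩
  rw [xiStar, hset, csInf_singleton]

/-- Under Fence Monotonicity, if i,j ∈ S are distinct with
ξ(j,S∖{i}) < ξ(j,S), then (a) everyone else pays no more in S∖{i} than in S, and
(b),(c) ξ(i,S∖{j}) = ξ(i,S) (both inequalities). -/
theorem stmt16 (ξ : Fin n → Finset (Fin n) → ℝ) (hξ : IsCostSharingScheme ξ)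
    (hFM : FenceMonotone ξ) (S : Finset (Fin n)) (i j : Fin n)
    (hi : i ∈ S) (hj : j ∈ S) (hij : i ≠ j)
    (h : ξ j (S.erase i) < ξ j S) :
    (∀ k ∈ S, k ≠ i → k ≠ j → ξ k (S.erase i) ≤ ξ k S) ∧
    ξ i (S.erase j) ≤ ξ i S ∧ ξ i S ≤ ξ i (S.erase j) := by
  refine ⟨fun k hk hki hkj => ?_, ?_, ?_⟩
  · by_contra! hlt
    obtain ⟨T, hLT, hTS, hT⟩ := (hFM (S.erase i) S (erase_subset i S)).1
    rcases eq_or_eq_erase_of_erase_subset hLT hTS with rfl | rfl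
    · have := hT j hj
      have := xiStar_le hξ Subset.rfl (erase_subset i T) (mem_erase.2 ⟨hij.symm, hj⟩)
      linarith
    · have := hT k (mem_erase.2 ⟨hki, hk⟩)
      have := xiStar_le hξ (erase_subset i S) Subset.rfl hk
      linarith
  · by_contra! hlt
    have hL : (S.erase j).erase i ⊆ S := (erase_subset _ _).trans (erase_subset _ _)
    obtain ⟨T, hLT, hTS, hiT, hT⟩ :=
      (hFM ((S.erase j).erase i) S hL).2.1 i (by simp [hi])
    by_cases hjT : j ∈ T
    · obtain rfl : T = S := by
        refine hTS.antisymm fun x hx => ?_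
        by_cases hxi : x = i
        · exact hxi ▸ hiT
        by_cases hxj : x = j
        · exact hxj ▸ hjT
        exact hLT (by simp [hxi, hxj, hx])
      have := hT j (by simp [hj])
      have := xiStar_le hξ (L := (T.erase j).erase i) (by grind) (erase_subset i T)
        (mem_erase.2 ⟨hij.symm, hj⟩)
      linarith
    · obtain rfl : T = S.erase j := by
        refine (subset_erase.2 ⟨hTS, hjT⟩).antisymm fun x hx => ?_
        by_cases hxi : x = i
        · exact hxi ▸ hiT
        exact hLT (mem_erase.2 ⟨hxi, hx⟩)
      have := hT i (by simp [hi, hij])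
      have := xiStar_le hξ hL Subset.rfl hi
      linarith
  · by_contra! hlt
    obtain ⟨T, ⟨t, ht⟩, hTL, hT⟩ := (hFM (S.erase i) S (erase_subset i S)).2.2 (S.erase j)
      (erase_ssubset hj) ⟨i, mem_erase.2 ⟨hij, hi⟩, by rwa [xiStar_erase_self hi]⟩
    have hT_eq : ∀ x ∈ T, x = j := fun x hx => by
      have := hTL hx
      grind
    obtain rfl := hT_eq t ht
    have hunion : S.erase t ∪ T = S := by grind
    have hpay := hT t ht
    rw [hunion] at hpay
    have := xiStar_le hξ Subset.rfl (erase_subset i S) (mem_erase.2 ⟨hij.symm, hj⟩)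
    linarith
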